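/- arXiv:0909.3928 — 5 statements merged into one kernel-verified Lean document; each statement's English description precedes it below -/
import Mathlib

section
/- Let φ be a Jacob's ladder with parameters T⁰, c₀, C, let ω > 0, and let (T_ν(ω))_{ν≥ν₀} be a strictly increasing sequence tending to infinity with ∫₀^{T_ν(ω)} |ζ(1/2+it)|² dt = ω·ν for all ν ≥ ν₀. Then there exists C' > 0 such that for all sufficiently large ν, | (1/2)·(φ(T_{ν+1}(ω)) − φ(T_ν(ω)))·(ln(φ(T_ν(ω))/2) − a) − ω | ≤ C'·(ln T_ν(ω))/T_ν(ω); equivalently, writing tan α(T_ν, T_{ν+1}) = (φ(T_{ν+1}(ω)) − φ(T_ν(ω))) / (2·(T_{ν+1}(ω) − T_ν(ω))) for the slope of the chord of the curve y = φ(T)/2 between the points (T_ν, φ(T_ν)/2) and (T_{ν+1}, φ(T_{ν+1})/2), one has T_{ν+1}(ω) − T_ν(ω) = (ω + O((ln T_ν)/T_ν)) / ((ln(φ(T_ν)/2) − a)·tan α(T_ν, T_{ν+1})). -/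
open Real MeasureTheory Filter

/-- `Z²(t) = |ζ(1/2 + it)|²`, the square of the modulus of Hardy's Z-function. -/
noncomputable def Z2 (t : ℝ) : ℝ := ‖riemannZeta (1/2 + t * Complex.I)‖ ^ 2

/-- The Hardy–Littlewood integral `I(T) = ∫₀^T |ζ(1/2+it)|² dt`. -/
noncomputable def HL (T : ℝ) : ℝ := ∫ t in (0:ℝ)..T, Z2 t

/-- `F(y) = (y/2)·ln(y/2) + (γ − ln 2π)·(y/2) + c₀`. -/
noncomputable def F (c₀ y : ℝ) : ℝ :=
  y / 2 * Real.log (y / 2)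
    + (Real.eulerMascheroniConstant - Real.log (2 * Real.pi)) * (y / 2) + c₀

/-- A Jacob's ladder with parameters `T⁰, c₀, C`. -/
structure JacobsLadder (φ : ℝ → ℝ) (T0 c₀ C : ℝ) : Prop where
  one_lt : 1 < T0
  contOn : ContinuousOn φ (Set.Ici T0)
  strictMonoOn : StrictMonoOn φ (Set.Ici T0)
  lower : ∀ T, T0 ≤ T → 1.9 * T < φ T
  upper : ∀ T, T0 ≤ T → φ T < 2 * T
  approx : ∀ T, T0 ≤ T → |HL T - F c₀ (φ T)| ≤ C * Real.log T / T

/-- `a = ln 2π − 1 − γ`. -/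
noncomputable def aConst : ℝ := Real.log (2 * Real.pi) - 1 - Real.eulerMascheroniConstant

set_option maxHeartbeats 1000000 in
/-- for a quantizing sequence `(T_ν(ω))` of a Jacob's ladder one has
`|(1/2)(φ(T_{ν+1}) − φ(T_ν))(ln(φ(T_ν)/2) − a) − ω| ≤ C'·(ln T_ν)/T_ν` for all large `ν`;
equivalently, with `tan α = (φ(T_{ν+1}) − φ(T_ν))/(2(T_{ν+1} − T_ν))`,
`T_{ν+1} − T_ν = (ω + O((ln T_ν)/T_ν)) / ((ln(φ(T_ν)/2) − a)·tan α)`. -/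
theorem gap_formula (φ : ℝ → ℝ) (T0 c₀ C : ℝ) (hφ : JacobsLadder φ T0 c₀ C)
    (ω : ℝ) (hω : 0 < ω) (ν₀ : ℕ) (T : ℕ → ℝ)
    (hmono : ∀ μ ν, ν₀ ≤ μ → μ < ν → T μ < T ν)
    (htend : Tendsto T atTop atTop)
    (hquant : ∀ ν, ν₀ ≤ ν → HL (T ν) = ω * ν) :
    ∃ C' > (0:ℝ), ∃ ν₁ : ℕ, ∀ ν, ν₁ ≤ ν →
      |(1/2) * (φ (T (ν + 1)) - φ (T ν)) * (Real.log (φ (T ν) / 2) - aConst) - ω|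
        ≤ C' * Real.log (T ν) / T ν ∧
      ∃ E : ℝ, |E| ≤ C' * Real.log (T ν) / T ν ∧
        T (ν + 1) - T ν
          = (ω + E) /
            ((Real.log (φ (T ν) / 2) - aConst) *
              ((φ (T (ν + 1)) - φ (T ν)) / (2 * (T (ν + 1) - T ν)))) := by
  have hT0 := hφ.one_lt
  have hlog : Tendsto (fun ν => Real.log (T ν)) atTop atTop := Real.tendsto_log_atTop.comp htend
  obtain ⟨ν₁, h1⟩ := eventually_atTop.1 ((htend.eventually_ge_atTop T0).and
    ((htend.eventually_ge_atTop (Real.exp 1)).and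
      ((hlog.eventually_ge_atTop (2 + aConst)).and (eventually_ge_atTop ν₀))))
  have hC : 0 ≤ C := by
    have h := (abs_nonneg _).trans (hφ.approx T0 le_rfl)
    have hl : 0 < Real.log T0 := Real.log_pos hT0
    by_contra hneg
    have : C * Real.log T0 / T0 < 0 :=
      div_neg_of_neg_of_pos (mul_neg_of_neg_of_pos (not_le.1 hneg) hl) (by linarith)
    linarith
  refine ⟨2 * C + 2 * (ω + 2 * C) ^ 2 + 1, by positivity, ν₁, fun ν hν => ?_⟩
  obtain ⟨ha, hb, hc, hd⟩ := h1 ν hν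
  have hlt : T ν < T (ν + 1) := hmono ν (ν + 1) hd (Nat.lt_succ_self ν)
  have q1 := hquant ν hd
  have q2 := hquant (ν + 1) (by omega)
  have A1 := hφ.approx _ ha
  have A2 := hφ.approx (T (ν + 1)) (by linarith)
  have hφlt : φ (T ν) < φ (T (ν + 1)) :=
    hφ.strictMonoOn (Set.mem_Ici.2 ha) (Set.mem_Ici.2 (by linarith)) hlt
  have hlow := hφ.lower _ ha
  rw [q1] at A1
  rw [q2] at A2
  have hanti : Real.log (T (ν + 1)) / T (ν + 1) ≤ Real.log (T ν) / T ν :=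
    Real.log_div_self_antitoneOn hb (show Real.exp 1 ≤ T (ν + 1) by linarith) hlt.le
  generalize T (ν + 1) = t' at *
  have htpos : 1 < T ν := by linarith
  have hlog1 : 1 ≤ Real.log (T ν) := by
    rw [Real.le_log_iff_exp_le (by linarith)]; exact hb
  have hlogle : Real.log (T ν) ≤ T ν := by
    have := Real.log_le_sub_one_of_pos (show 0 < T ν by linarith)
    linarith
  generalize T ν = t at *
  obtain ⟨x, hx⟩ : ∃ x, x = φ t / 2 := ⟨_, rfl⟩
  obtain ⟨y, hy⟩ : ∃ y, y = φ t' / 2 := ⟨_, rfl⟩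
  have hxt : t / 2 < x := by rw [hx]; norm_num at hlow; linarith
  have hxy : x < y := by rw [hx, hy]; linarith
  have hxpos : 0 < x := by linarith
  have hypos : 0 < y := by linarith
  unfold F at A1 A2
  rw [← hx] at A1 ⊢
  rw [← hy] at A2
  have e1 : φ t = 2 * x := by rw [hx]; ring
  have e2 : φ t' = 2 * y := by rw [hy]; ring
  rw [e1, e2]
  obtain ⟨r, hr⟩ : ∃ r, r = Real.log t / t := ⟨_, rfl⟩
  rw [mul_div_assoc] at A1 A2 ⊢
  rw [← hr] at A1 hanti ⊢
  have hr1 : r ≤ 1 := by rw [hr, div_le_one (by linarith)]; exact hlogle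
  have hrt : 1 / t ≤ r := by rw [hr]; gcongr
  have A2' := A2.trans (mul_le_mul_of_nonneg_left hanti hC)
  -- log bounds
  have l1 : Real.log y - Real.log x ≤ (y - x) / x := by
    rw [← Real.log_div hypos.ne' hxpos.ne']
    have := Real.log_le_sub_one_of_pos (div_pos hypos hxpos)
    rw [sub_div, div_self hxpos.ne']; exact this
  have l2 : (y - x) / y ≤ Real.log y - Real.log x := by
    have := Real.log_le_sub_one_of_pos (div_pos hxpos hypos)
    rw [Real.log_div hxpos.ne' hypos.ne'] at this
    rw [sub_div, div_self hypos.ne']; linarith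
  have l2' : y - x ≤ y * (Real.log y - Real.log x) := by
    rw [div_le_iff₀ hypos] at l2; linarith
  have hlx : 1 ≤ Real.log x - aConst := by
    have h2 : Real.log (t / 2) ≤ Real.log x := Real.log_le_log (by linarith) hxt.le
    rw [Real.log_div (by linarith) (by norm_num)] at h2
    have := Real.log_two_lt_d9
    linarith
  have B1 := abs_le.1 A1
  have B2 := abs_le.1 A2'
  push_cast at B2
  obtain ⟨L, hL⟩ : ∃ L, L = Real.log x - aConst := ⟨_, rfl⟩
  obtain ⟨D, hD⟩ : ∃ D, D = Real.log y - Real.log x := ⟨_, rfl⟩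
  have ex : Real.log x = L + aConst := by linarith
  have ey : Real.log y = D + L + aConst := by linarith
  rw [← hD] at l1 l2'
  rw [ex] at B1 hlx ⊢
  rw [ey] at B2
  obtain ⟨B11, B12⟩ := B1
  obtain ⟨B21, B22⟩ := B2
  have ediff : (y * (D + L + aConst) + (eulerMascheroniConstant - Real.log (2 * π)) * y + c₀)
      - (x * (L + aConst) + (eulerMascheroniConstant - Real.log (2 * π)) * x + c₀)
      = (y - x) * L + (y * D - (y - x)) := by
    unfold aConst; ring
  have hLL : L + aConst - aConst = L := by ring
  rw [hLL] at hlx ⊢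
  have u1 : (y - x) * L ≤ ω + 2 * C * r := by linarith
  have hCr : C * r ≤ C := mul_le_of_le_one_right hC hr1
  have u2 : y - x ≤ ω + 2 * C := by
    have := le_mul_of_one_le_right (sub_nonneg.2 hxy.le) hlx
    linarith
  have u3 : y * D - (y - x) ≤ (y - x) ^ 2 / x := by
    have := mul_le_mul_of_nonneg_left l1 hypos.le
    have e : y * ((y - x) / x) = (y - x) ^ 2 / x + (y - x) := by field_simp; ring
    linarith
  have u4 : (y - x) ^ 2 / x ≤ 2 * (ω + 2 * C) ^ 2 * r := by
    have h1 : (y - x) ^ 2 ≤ (ω + 2 * C) ^ 2 := by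
      apply pow_le_pow_left₀ (by linarith) u2
    calc (y - x) ^ 2 / x ≤ (ω + 2 * C) ^ 2 / (t / 2) := by gcongr
      _ = 2 * (ω + 2 * C) ^ 2 * (1 / t) := by field_simp
      _ ≤ _ := by gcongr
  have hrpos : 0 < r := lt_of_lt_of_le (by positivity) hrt
  have main : |1 / 2 * (2 * y - 2 * x) * L - ω| ≤ (2 * C + 2 * (ω + 2 * C) ^ 2 + 1) * r := by
    have hs : 0 ≤ (ω + 2 * C) ^ 2 * r := by positivity
    have e : 1 / 2 * (2 * y - 2 * x) * L = (y - x) * L := by ring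
    rw [e, abs_le]
    constructor <;> linarith
  refine ⟨main, _, main, ?_⟩
  have h3 : y - x ≠ 0 := ne_of_gt (by linarith)
  have h4 : t' - t ≠ 0 := ne_of_gt (by linarith)
  have h5 : L ≠ 0 := ne_of_gt (by linarith)
  have e3 : 2 * y - 2 * x = 2 * (y - x) := by ring
  rw [e3]
  field_simp
  ring
end

section
/- Let φ be a Jacob's ladder with parameters T⁰, c₀, C, let ω > 0, and let (T_ν(ω))_{ν≥ν₀} be a strictly increasing sequence tending to infinity with ∫₀^{T_ν(ω)} |ζ(1/2+it)|² dt = ω·ν for all ν ≥ ν₀. Then there exists a constant C'' > 0 such that for all sufficiently large ν, 0 < φ(T_{ν+1}(ω)) − φ(T_ν(ω)) ≤ C''/ln T_ν(ω). -/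
open Real MeasureTheory Filter

/-- for a quantizing sequence `(T_ν(ω))` of a Jacob's ladder there is
`C'' > 0` with `0 < φ(T_{ν+1}) − φ(T_ν) ≤ C''/ln T_ν` for all large `ν`. -/
theorem phi_gap_bound (φ : ℝ → ℝ) (T0 c₀ C : ℝ) (hφ : JacobsLadder φ T0 c₀ C)
    (ω : ℝ) (hω : 0 < ω) (ν₀ : ℕ) (T : ℕ → ℝ)
    (hmono : ∀ μ ν, ν₀ ≤ μ → μ < ν → T μ < T ν)
    (htend : Tendsto T atTop atTop)
    (hquant : ∀ ν, ν₀ ≤ ν → HL (T ν) = ω * ν) :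
    ∃ C'' > (0:ℝ), ∃ ν₁ : ℕ, ∀ ν, ν₁ ≤ ν →
      0 < φ (T (ν + 1)) - φ (T ν) ∧
      φ (T (ν + 1)) - φ (T ν) ≤ C'' / Real.log (T ν) := by
  set k : ℝ := Real.eulerMascheroniConstant - Real.log (2 * Real.pi) with hk
  set D : ℝ := ω + 2 * |C| with hD
  have hDpos : 0 < D := by positivity
  have hlog : Tendsto (fun n => Real.log (T n)) atTop atTop := Real.tendsto_log_atTop.comp htend
  obtain ⟨N, hN⟩ := eventually_atTop.1 ((htend.eventually_ge_atTop T0).and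
    ((hlog.eventually_ge_atTop (2 * (1 + |k|))).and (eventually_ge_atTop ν₀)))
  refine ⟨4 * D, by positivity, N, fun ν hν => ?_⟩
  obtain ⟨h0, hL, hv⟩ := hN ν hν
  obtain ⟨h0', -, hv'⟩ := hN (ν + 1) (by omega)
  have h1 := hφ.one_lt
  have hlt : φ (T ν) < φ (T (ν + 1)) :=
    hφ.strictMonoOn h0 h0' (hmono ν (ν + 1) hv (Nat.lt_succ_self ν))
  refine ⟨by linarith, ?_⟩
  have key : ∀ t, T0 ≤ t → |HL t - F c₀ (φ t)| ≤ |C| := by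
    intro t ht
    have htp : 0 < t := by linarith
    have hlt0 : 0 ≤ Real.log t := Real.log_nonneg (by linarith)
    have hle : Real.log t ≤ t := (Real.log_le_sub_one_of_pos htp).trans (by linarith)
    refine (hφ.approx t ht).trans ?_
    rw [div_le_iff₀ htp]
    calc C * Real.log t ≤ |C| * Real.log t := mul_le_mul_of_nonneg_right (le_abs_self C) hlt0
      _ ≤ |C| * t := mul_le_mul_of_nonneg_left hle (abs_nonneg C)
  have a1 := abs_le.1 (key _ h0)
  have a2 := abs_le.1 (key _ h0')
  rw [hquant ν hv] at a1
  rw [hquant (ν + 1) hv'] at a2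
  push_cast at a2
  have hlow := hφ.lower _ h0
  have hTpos : 0 < T ν := by linarith
  obtain ⟨x, hx⟩ : ∃ x, x = φ (T ν) / 2 := ⟨_, rfl⟩
  obtain ⟨y, hy⟩ : ∃ y, y = φ (T (ν + 1)) / 2 := ⟨_, rfl⟩
  have hxT : T ν / 2 ≤ x := by rw [hx]; norm_num at hlow; linarith
  have hxpos : 0 < x := by linarith
  have hxy : x < y := by rw [hx, hy]; linarith
  have hF : F c₀ (φ (T (ν + 1))) - F c₀ (φ (T ν)) ≤ D := by
    rw [hD]; linarith [a1.1, a1.2, a2.1, a2.2]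
  unfold F at hF
  rw [← hx, ← hy, ← hk] at hF
  have hlogxy : Real.log x ≤ Real.log y := Real.log_le_log hxpos hxy.le
  have hlogx : Real.log (T ν) - 1 ≤ Real.log x := by
    have := Real.log_le_log (by linarith) hxT
    rw [Real.log_div hTpos.ne' two_ne_zero] at this
    linarith [Real.log_two_lt_d9]
  have hhalf : Real.log (T ν) / 2 ≤ Real.log x + k := by linarith [neg_abs_le k]
  have hLpos : 0 < Real.log (T ν) := by linarith [abs_nonneg k]
  have hm : y * Real.log x ≤ y * Real.log y :=
    mul_le_mul_of_nonneg_left hlogxy (by linarith)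
  have hm2 := mul_le_mul_of_nonneg_left hhalf (sub_nonneg.2 hxy.le)
  rw [le_div_iff₀ hLpos]
  have e : φ (T (ν + 1)) - φ (T ν) = 2 * (y - x) := by rw [hx, hy]; ring
  rw [e]
  linarith
end

section
/- Let φ be a Jacob's ladder with parameters T⁰, c₀, C, let ω > 0, and let (T_ν(ω))_{ν≥ν₀} be a strictly increasing sequence tending to infinity with ∫₀^{T_ν(ω)} |ζ(1/2+it)|² dt = ω·ν for all ν ≥ ν₀. Writing tan α(T_ν, T_{ν+1}) = (φ(T_{ν+1}(ω)) − φ(T_ν(ω))) / (2·(T_{ν+1}(ω) − T_ν(ω))), there exists C''' > 0 such that for all sufficiently large ν, | ∫_{T_ν(ω)}^{T_{ν+1}(ω)} |ζ(1/2+it)|² dt − (T_{ν+1}(ω) − T_ν(ω))·ln(e^{−a}·φ(T_ν(ω))/2)·tan α(T_ν, T_{ν+1}) | ≤ C'''·(ln T_ν(ω))/T_ν(ω). -/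
open Real MeasureTheory Filter

theorem Z2_continuous : Continuous Z2 := by
  unfold Z2
  refine Continuous.pow (Continuous.norm ?_) 2
  rw [continuous_iff_continuousAt]
  intro t
  have hne : (1 / 2 + (t : ℂ) * Complex.I) ≠ 1 := by
    intro h
    have := congrArg Complex.re h
    norm_num at this
  have h1 : ContinuousAt riemannZeta (1 / 2 + (t : ℂ) * Complex.I) :=
    (differentiableAt_riemannZeta hne).continuousAt
  have h2 : ContinuousAt (fun t : ℝ => (1 / 2 + (t : ℂ) * Complex.I)) t := by fun_prop
  exact ContinuousAt.comp (f := fun t : ℝ => (1 / 2 + (t : ℂ) * Complex.I)) h1 h2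

/-- Second order Taylor bounds for `u log u`. -/
theorem taylor_bounds (x y : ℝ) (hx : 0 < x) (hxy : x < y) :
    0 ≤ y * Real.log y - x * Real.log x - (Real.log x + 1) * (y - x) ∧
    y * Real.log y - x * Real.log x - (Real.log x + 1) * (y - x) ≤ (y - x) ^ 2 / x := by
  have hy : 0 < y := hx.trans hxy
  have e : y * Real.log y - x * Real.log x - (Real.log x + 1) * (y - x)
      = y * (Real.log y - Real.log x) - (y - x) := by ring
  have h1 := Real.log_le_sub_one_of_pos (div_pos hy hx)
  have h2 := Real.log_le_sub_one_of_pos (div_pos hx hy)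
  rw [Real.log_div hy.ne' hx.ne'] at h1
  rw [Real.log_div hx.ne' hy.ne'] at h2
  have h1' := mul_le_mul_of_nonneg_left h1 hy.le
  have h2' := mul_le_mul_of_nonneg_left h2 hy.le
  have e1 : y * (y / x - 1) - (y - x) = (y - x) ^ 2 / x := by field_simp
  have e2 : y * (x / y - 1) = x - y := by field_simp
  rw [e]
  constructor <;> linarith

/-- for a quantizing sequence `(T_ν(ω))` of a Jacob's ladder, with
`tan α = (φ(T_{ν+1}) − φ(T_ν))/(2(T_{ν+1} − T_ν))`, there is `C''' > 0` with
`|∫_{T_ν}^{T_{ν+1}} Z² − (T_{ν+1} − T_ν)·ln(e^{−a}·φ(T_ν)/2)·tan α| ≤ C'''·(ln T_ν)/T_ν`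
for all large `ν`. -/
theorem chord_mean_value_formula (φ : ℝ → ℝ) (T0 c₀ C : ℝ) (hφ : JacobsLadder φ T0 c₀ C)
    (ω : ℝ) (hω : 0 < ω) (ν₀ : ℕ) (T : ℕ → ℝ)
    (hmono : ∀ μ ν, ν₀ ≤ μ → μ < ν → T μ < T ν)
    (htend : Tendsto T atTop atTop)
    (hquant : ∀ ν, ν₀ ≤ ν → HL (T ν) = ω * ν) :
    ∃ C''' > (0:ℝ), ∃ ν₁ : ℕ, ∀ ν, ν₁ ≤ ν →
      |(∫ t in (T ν)..(T (ν + 1)), Z2 t)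
          - (T (ν + 1) - T ν) * Real.log (Real.exp (-aConst) * (φ (T ν) / 2)) *
            ((φ (T (ν + 1)) - φ (T ν)) / (2 * (T (ν + 1) - T ν)))|
        ≤ C''' * Real.log (T ν) / T ν := by
  have hT0 := hφ.one_lt
  have hC : 0 ≤ C := by
    have h := (abs_nonneg _).trans (hφ.approx T0 le_rfl)
    have hl : 0 < Real.log T0 := Real.log_pos hT0
    by_contra hneg
    push Not at hneg
    have : C * Real.log T0 / T0 < 0 :=
      div_neg_of_neg_of_pos (mul_neg_of_neg_of_pos hneg hl) (by linarith)
    linarith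
  set K := ω + 2 * C with hK
  have hev := htend.eventually (eventually_ge_atTop
    (max T0 (max (Real.exp 1) (2 * Real.exp (aConst + 1)))))
  obtain ⟨ν₂, hν₂⟩ := eventually_atTop.1 hev
  refine ⟨2 * K ^ 2 + 2 * C + 1, by positivity, max ν₀ ν₂, fun ν hν => ?_⟩
  have hν0 : ν₀ ≤ ν := (le_max_left _ _).trans hν
  have hbig := hν₂ ν ((le_max_right _ _).trans hν)
  have hlt : T ν < T (ν + 1) := hmono ν (ν + 1) hν0 (Nat.lt_succ_self ν)
  have hq1 := hquant ν hν0
  have hq2 := hquant (ν + 1) (by omega)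
  have hint : (∫ t in (T ν)..(T (ν + 1)), Z2 t) = ω := by
    have := intervalIntegral.integral_interval_sub_left
      (Z2_continuous.intervalIntegrable (μ := volume) 0 (T (ν + 1)))
      (Z2_continuous.intervalIntegrable (μ := volume) 0 (T ν))
    rw [← this]
    change HL (T (ν + 1)) - HL (T ν) = ω
    rw [hq1, hq2]
    push_cast
    ring
  rw [hint]
  have ha1 : T0 ≤ T ν := (le_max_left _ _).trans hbig
  have ha2 : Real.exp 1 ≤ T ν := (le_max_left _ _).trans ((le_max_right _ _).trans hbig)
  have ha3 : 2 * Real.exp (aConst + 1) ≤ T ν :=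
    (le_max_right _ _).trans ((le_max_right _ _).trans hbig)
  have hA1 := hφ.approx (T ν) ha1
  have hA2 := hφ.approx (T (ν + 1)) (ha1.trans hlt.le)
  have hlow := hφ.lower (T ν) ha1
  have hmon := hφ.strictMonoOn (Set.mem_Ici.2 ha1) (Set.mem_Ici.2 (ha1.trans hlt.le)) hlt
  rw [hq1] at hA1
  rw [hq2] at hA2
  generalize T (ν + 1) = S at *
  generalize T ν = R at *
  have hR : 0 < R := by linarith
  have hanti : Real.log S / S ≤ Real.log R / R :=
    Real.log_div_self_antitoneOn (Set.mem_ofPred.2 ha2) (Set.mem_ofPred.2 (ha2.trans hlt.le)) hlt.le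
  have hlogR : 1 ≤ Real.log R := (Real.le_log_iff_exp_le hR).2 ha2
  have hL1 : Real.log R / R ≤ 1 := by
    rw [div_le_one hR]
    have := Real.log_le_sub_one_of_pos hR
    linarith
  have hL0 : 1 / R ≤ Real.log R / R := by gcongr
  rw [mul_div_assoc] at hA1 hA2 ⊢
  have hA2' := hA2.trans (mul_le_mul_of_nonneg_left hanti hC)
  have hCL : C * (Real.log R / R) ≤ C := by nlinarith
  set L := Real.log R / R with hL
  obtain ⟨x, hx⟩ : ∃ x, x = φ R / 2 := ⟨_, rfl⟩
  obtain ⟨y, hy⟩ : ∃ y, y = φ S / 2 := ⟨_, rfl⟩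
  have hxR : R / 2 ≤ x := by rw [hx]; norm_num at hlow; linarith
  have hx0 : 0 < x := by linarith
  have hxy : x < y := by rw [hx, hy]; linarith
  obtain ⟨t1, t2⟩ := taylor_bounds x y hx0 hxy
  have hlogx : aConst + 1 ≤ Real.log x :=
    (Real.le_log_iff_exp_le hx0).2 (by linarith)
  have hmain : (S - R) * Real.log (Real.exp (-aConst) * (φ R / 2)) *
      ((φ S - φ R) / (2 * (S - R))) = (Real.log x - aConst) * (y - x) := by
    rw [← hx, Real.log_mul (Real.exp_pos _).ne' hx0.ne', Real.log_exp]
    have : S - R ≠ 0 := by linarith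
    rw [hx, hy]
    field_simp
    ring
  rw [hmain]
  unfold F at hA1 hA2'
  rw [← hx] at hA1
  rw [← hy] at hA2'
  push_cast at hA2'
  rw [abs_le] at hA1 hA2'
  unfold aConst at *
  set k := Real.eulerMascheroniConstant
  set l := Real.log (2 * Real.pi)
  have hyx : y - x ≤ K := by
    have : (y - x) * 1 ≤ (y - x) * (Real.log x - (l - 1 - k)) := by
      apply mul_le_mul_of_nonneg_left <;> linarith
    linarith [hA1.1, hA1.2, hA2'.1, hA2'.2]
  have hsq : (y - x) ^ 2 / x ≤ 2 * K ^ 2 * L := by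
    calc (y - x) ^ 2 / x ≤ K ^ 2 / (R / 2) := by
          gcongr
      _ = 2 * K ^ 2 * (1 / R) := by field_simp
      _ ≤ _ := by gcongr
  have hLp : 0 ≤ L := le_trans (by positivity) hL0
  have hKL : 0 ≤ 2 * K ^ 2 * L := by positivity
  rw [abs_le]
  constructor <;> linarith [hA1.1, hA1.2, hA2'.1, hA2'.2]
end

section
/- Let φ be a Jacob's ladder with parameters T⁰, c₀, C, let ω > 0, τ ∈ [0, ω), and let (T_ν(ω,τ))_{ν≥ν₀} be a strictly increasing sequence tending to infinity with ∫₀^{T_ν(ω,τ)} |ζ(1/2+it)|² dt = ω·ν + τ for all ν ≥ ν₀. Then there exists C' > 0 such that for all sufficiently large ν, | (1/2)·(φ(T_{ν+1}(ω,τ)) − φ(T_ν(ω,τ)))·(ln(φ(T_ν(ω,τ))/2) − a) − ω | ≤ C'·(ln T_ν(ω,τ))/T_ν(ω,τ); equivalently, writing tan α(T_ν, T_{ν+1}) = (φ(T_{ν+1}(ω,τ)) − φ(T_ν(ω,τ))) / (2·(T_{ν+1}(ω,τ) − T_ν(ω,τ))), one has T_{ν+1}(ω,τ) − T_ν(ω,τ)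 = (ω + O((ln T_ν)/T_ν)) / ((ln(φ(T_ν)/2) − a)·tan α(T_ν, T_{ν+1})). -/
open Real MeasureTheory Filter

/-- for a shifted quantizing sequence `(T_ν(ω,τ))` of a Jacob's ladder one has
`|(1/2)(φ(T_{ν+1}) − φ(T_ν))(ln(φ(T_ν)/2) − a) − ω| ≤ C'·(ln T_ν)/T_ν` for all large `ν`;
equivalently, with `tan α = (φ(T_{ν+1}) − φ(T_ν))/(2(T_{ν+1} − T_ν))`,
`T_{ν+1} − T_ν = (ω + O((ln T_ν)/T_ν)) / ((ln(φ(T_ν)/2) − a)·tan α)`. -/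
theorem gap_formula_shifted (φ : ℝ → ℝ) (T0 c₀ C : ℝ) (hφ : JacobsLadder φ T0 c₀ C)
    (ω τ : ℝ) (hω : 0 < ω) (hτ : 0 ≤ τ) (hτω : τ < ω) (ν₀ : ℕ) (T : ℕ → ℝ)
    (hmono : ∀ μ ν, ν₀ ≤ μ → μ < ν → T μ < T ν)
    (htend : Tendsto T atTop atTop)
    (hquant : ∀ ν, ν₀ ≤ ν → HL (T ν) = ω * ν + τ) :
    ∃ C' > (0:ℝ), ∃ ν₁ : ℕ, ∀ ν, ν₁ ≤ ν →
      |(1/2) * (φ (T (ν + 1)) - φ (T ν)) * (Real.log (φ (T ν) / 2) - aConst) - ω|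
        ≤ C' * Real.log (T ν) / T ν ∧
      ∃ E : ℝ, |E| ≤ C' * Real.log (T ν) / T ν ∧
        T (ν + 1) - T ν
          = (ω + E) /
            ((Real.log (φ (T ν) / 2) - aConst) *
              ((φ (T (ν + 1)) - φ (T ν)) / (2 * (T (ν + 1) - T ν)))) := by
  obtain ⟨N, hN⟩ := eventually_atTop.1
    (htend.eventually_ge_atTop (max T0 (max (Real.exp 1) (2 * Real.exp (aConst + 1)))))
  set K : ℝ := ω + 2 * |C| with hK
  have hC0 : 0 ≤ |C| := abs_nonneg C
  have hKpos : 0 < K := by positivity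
  refine ⟨2 * |C| + 2 * K ^ 2, by positivity, max N ν₀, fun ν hν => ?_⟩
  have hνN : N ≤ ν := le_trans (le_max_left _ _) hν
  have hν0 : ν₀ ≤ ν := le_trans (le_max_right _ _) hν
  have hbig := hN ν hνN
  have h1 : T0 ≤ T ν := le_trans (le_max_left _ _) hbig
  have h2 : Real.exp 1 ≤ T ν :=
    le_trans (le_trans (le_max_left _ _) (le_max_right _ _)) hbig
  have h3 : 2 * Real.exp (aConst + 1) ≤ T ν :=
    le_trans (le_trans (le_max_right _ _) (le_max_right _ _)) hbig
  have hlt : T ν < T (ν + 1) := hmono ν (ν + 1) hν0 (Nat.lt_succ_self ν)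
  have h1' : T0 ≤ T (ν + 1) := h1.trans hlt.le
  have hφlt : φ (T ν) < φ (T (ν + 1)) := hφ.strictMonoOn h1 h1' hlt
  have hlow := hφ.lower _ h1
  have e1 := hφ.approx _ h1
  have e2 := hφ.approx _ h1'
  have q1 := hquant ν hν0
  have q2 := hquant (ν + 1) (by omega)
  push_cast at q2
  have hTpos : 0 < T ν := lt_of_lt_of_le (Real.exp_pos 1) h2
  have hTpos' : 0 < T (ν + 1) := hTpos.trans hlt
  have hlogT : 1 ≤ Real.log (T ν) := (Real.le_log_iff_exp_le hTpos).2 h2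
  have hanti : Real.log (T (ν + 1)) / T (ν + 1) ≤ Real.log (T ν) / T ν :=
    Real.log_div_self_antitoneOn h2 (h2.trans hlt.le) hlt.le
  set δ : ℝ := Real.log (T ν) / T ν with hδ
  have hδ1 : δ ≤ 1 := by
    rw [hδ, div_le_one hTpos]
    linarith [Real.log_le_sub_one_of_pos hTpos]
  have hinv : 1 / T ν ≤ δ := by
    rw [hδ]; gcongr
  have hδ0 : 0 ≤ δ := le_trans (by positivity) hinv
  have e1' : |HL (T ν) - F c₀ (φ (T ν))| ≤ |C| * δ := by
    refine e1.trans ?_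
    rw [mul_div_assoc]
    exact mul_le_mul_of_nonneg_right (le_abs_self C) hδ0
  have hδ'0 : 0 ≤ Real.log (T (ν + 1)) / T (ν + 1) := by
    apply div_nonneg _ hTpos'.le
    linarith [Real.log_le_log hTpos hlt.le]
  have e2' : |HL (T (ν + 1)) - F c₀ (φ (T (ν + 1)))| ≤ |C| * δ := by
    refine e2.trans ?_
    rw [mul_div_assoc]
    exact mul_le_mul (le_abs_self C) hanti hδ'0 hC0
  rw [q1] at e1'
  rw [q2] at e2'
  unfold F at e1' e2'
  set x : ℝ := φ (T ν) / 2 with hx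
  set y : ℝ := φ (T (ν + 1)) / 2 with hy
  have hxy : x < y := by rw [hx, hy]; linarith
  have hxT : T ν / 2 ≤ x := by rw [hx]; norm_num at hlow; linarith
  have hxpos : 0 < x := by linarith
  have hypos : 0 < y := hxpos.trans hxy
  have hL : 1 ≤ Real.log x - aConst := by
    have : aConst + 1 ≤ Real.log x := (Real.le_log_iff_exp_le hxpos).2 (by linarith)
    linarith
  have r1 : Real.log y - Real.log x ≤ (y - x) / x := by
    have := Real.log_le_sub_one_of_pos (div_pos hypos hxpos)
    rw [Real.log_div hypos.ne' hxpos.ne'] at this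
    rw [sub_div, div_self hxpos.ne']; exact this
  have r2 : (y - x) / y ≤ Real.log y - Real.log x := by
    have := Real.log_le_sub_one_of_pos (div_pos hxpos hypos)
    rw [Real.log_div hxpos.ne' hypos.ne'] at this
    rw [sub_div, div_self hypos.ne']; linarith
  have r2' : y - x ≤ (Real.log y - Real.log x) * y := (div_le_iff₀ hypos).1 r2
  have r1' : (Real.log y - Real.log x) * y ≤ (y - x) / x * y :=
    mul_le_mul_of_nonneg_right r1 hypos.le
  have r3 : (y - x) / x * y = (y - x) + (y - x) ^ 2 / x := by field_simp; ring
  obtain ⟨a1, a2⟩ := abs_le.1 e1'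
  obtain ⟨b1, b2⟩ := abs_le.1 e2'
  have hCδ : |C| * δ ≤ |C| := mul_le_of_le_one_right hC0 hδ1
  have hQ : (y - x) * (Real.log x - aConst) + ((Real.log y - Real.log x) * y - (y - x))
      = (y * Real.log y + (Real.eulerMascheroniConstant - Real.log (2 * Real.pi)) * y)
        - (x * Real.log x + (Real.eulerMascheroniConstant - Real.log (2 * Real.pi)) * x) := by
    unfold aConst; ring
  have hle : (y - x) * (Real.log x - aConst) ≤ ω + 2 * (|C| * δ) := by linarith
  have hyx : y - x ≤ K := by
    have : y - x ≤ (y - x) * (Real.log x - aConst) :=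
      le_mul_of_one_le_right (by linarith) hL
    linarith
  have hsq : (y - x) ^ 2 / x ≤ 2 * K ^ 2 * δ := by
    have s1 : (y - x) ^ 2 ≤ K ^ 2 := pow_le_pow_left₀ (by linarith) hyx 2
    calc (y - x) ^ 2 / x ≤ K ^ 2 / (T ν / 2) := by gcongr
      _ = 2 * K ^ 2 * (1 / T ν) := by field_simp
      _ ≤ 2 * K ^ 2 * δ := by gcongr
  have hKδ : 0 ≤ 2 * K ^ 2 * δ := by positivity
  have hhalf : (1/2) * (φ (T (ν + 1)) - φ (T ν)) = y - x := by rw [hx, hy]; ring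
  have main : |(1/2) * (φ (T (ν + 1)) - φ (T ν)) * (Real.log x - aConst) - ω|
      ≤ (2 * |C| + 2 * K ^ 2) * Real.log (T ν) / T ν := by
    rw [hhalf, mul_div_assoc, ← hδ, abs_le]
    constructor <;> linarith
  refine ⟨main, _, main, ?_⟩
  have hΔ : T (ν + 1) - T ν ≠ 0 := by apply ne_of_gt; linarith
  have hne : y - x ≠ 0 := by apply ne_of_gt; linarith
  have hLne : Real.log x - aConst ≠ 0 := by apply ne_of_gt; linarith
  have hfr : (φ (T (ν + 1)) - φ (T ν)) / (2 * (T (ν + 1) - T ν))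
      = (y - x) / (T (ν + 1) - T ν) := by
    rw [← hhalf]; field_simp
  rw [hfr, hhalf]
  field_simp
  ring
end

section
/- Assume the Balasubramanian asymptotic: for some ε ∈ (0, 1/100) there is a constant B > 0 with |∫₀^T |ζ(1/2+it)|² dt − (T·ln T + (2γ − 1 − ln(2π))·T)| ≤ B·T^{1/3+ε} for all large T. Let ω > 0 and let (T_ν(ω))_{ν≥ν₀} be a strictly increasing sequence tending to infinity with ∫₀^{T_ν(ω)} |ζ(1/2+it)|² dt = ω·ν for all ν ≥ ν₀. Suppose N₀ : ℕ → ℕ is such that (T_{ν+N₀(ν)}(ω) − T_ν(ω)) / T_ν(ω)^{1/3+2ε} → 1 as ν → ∞. Then the arithmetic means of the gaps satisfy ( (1/N₀(ν))·Σ_{k=1}^{N₀(ν)} (T_{ν+k}(ω) − T_{ν+k−1}(ω)) ) · (ln T_ν(ω))/ω → 1 as ν → ∞. -/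
open Real MeasureTheory Filter

/-- assuming the Balasubramanian asymptotic with error `O(T^{1/3+ε})`, for a
quantizing sequence `(T_ν(ω))` and `N₀(ν)` with `(T_{ν+N₀(ν)} − T_ν)/T_ν^{1/3+2ε} → 1`,
the arithmetic means of the gaps satisfy
`((1/N₀(ν))·Σ_{k=1}^{N₀(ν)} (T_{ν+k} − T_{ν+k−1}))·(ln T_ν)/ω → 1`. -/
theorem mean_gap_asymptotic (ε : ℝ) (hε : 0 < ε) (hε' : ε < 1/100) (B : ℝ) (hB : 0 < B)
    (hBala : ∃ T₁ : ℝ, ∀ T : ℝ, T₁ ≤ T →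
      |HL T - (T * Real.log T
          + (2 * Real.eulerMascheroniConstant - 1 - Real.log (2 * Real.pi)) * T)|
        ≤ B * T ^ ((1:ℝ)/3 + ε))
    (ω : ℝ) (hω : 0 < ω) (ν₀ : ℕ) (T : ℕ → ℝ)
    (hmono : ∀ μ ν, ν₀ ≤ μ → μ < ν → T μ < T ν)
    (htend : Tendsto T atTop atTop)
    (hquant : ∀ ν, ν₀ ≤ ν → HL (T ν) = ω * ν)
    (N₀ : ℕ → ℕ)
    (hN₀ : Tendsto (fun ν => (T (ν + N₀ ν) - T ν) / (T ν) ^ ((1:ℝ)/3 + 2 * ε))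
      atTop (nhds 1)) :
    Tendsto
      (fun ν => ((1 / (N₀ ν : ℝ)) *
          ∑ k ∈ Finset.range (N₀ ν), (T (ν + k + 1) - T (ν + k))) *
        (Real.log (T ν) / ω))
      atTop (nhds 1) := by
  obtain ⟨T₁, hT₁⟩ := hBala
  set c : ℝ := 2 * Real.eulerMascheroniConstant - 1 - Real.log (2 * Real.pi) with hc
  have hlog : Tendsto (fun ν => Real.log (T ν)) atTop atTop :=
    Real.tendsto_log_atTop.comp htend
  have key : Tendsto (fun ν => (ω * (N₀ ν : ℝ)) / ((T (ν + N₀ ν) - T ν) * Real.log (T ν)))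
      atTop (nhds 1) := by
    rw [tendsto_iff_norm_sub_tendsto_zero]
    have hz : Tendsto (fun ν => (3 + |c| + 8 * B) / Real.log (T ν)) atTop (nhds 0) :=
      hlog.const_div_atTop _
    refine squeeze_zero' (Eventually.of_forall fun ν => norm_nonneg _) ?_ hz
    filter_upwards [eventually_ge_atTop ν₀, htend.eventually_ge_atTop T₁,
      htend.eventually_gt_atTop 1, hlog.eventually_gt_atTop 0,
      hN₀.eventually (lt_mem_nhds (show (1/2:ℝ) < 1 by norm_num)),
      hN₀.eventually (gt_mem_nhds (show (1:ℝ) < 2 by norm_num))] with ν h0 h1 h2 h3 h4 h5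
    have e1 := hquant ν h0
    have e2 := hquant (ν + N₀ ν) (by omega)
    push_cast at e2
    have b1 := hT₁ (T ν) h1
    generalize hx : T ν = x at *
    have b2 := hT₁ (T (ν + N₀ ν))
    generalize hy : T (ν + N₀ ν) = y at *
    have hx0 : 0 < x := by linarith
    have hq : 0 < x ^ ((1:ℝ)/3 + 2 * ε) := Real.rpow_pos_of_pos hx0 _
    rw [lt_div_iff₀ hq] at h4
    rw [div_lt_iff₀ hq] at h5
    have hqx : x ^ ((1:ℝ)/3 + 2 * ε) ≤ x := by
      calc x ^ ((1:ℝ)/3 + 2 * ε) ≤ x ^ (1:ℝ) :=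
            Real.rpow_le_rpow_of_exponent_le h2.le (by linarith)
        _ = x := Real.rpow_one x
    have hpq : x ^ ((1:ℝ)/3 + ε) ≤ x ^ ((1:ℝ)/3 + 2 * ε) :=
      Real.rpow_le_rpow_of_exponent_le h2.le (by linarith)
    have hh : 0 < y - x := by linarith
    have hy0 : 0 < y := by linarith
    have hy3 : y ≤ 3 * x := by linarith
    have hyp : y ^ ((1:ℝ)/3 + ε) ≤ 3 * x ^ ((1:ℝ)/3 + ε) := by
      calc y ^ ((1:ℝ)/3 + ε) ≤ (3 * x) ^ ((1:ℝ)/3 + ε) :=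
            Real.rpow_le_rpow hy0.le hy3 (by linarith)
        _ = 3 ^ ((1:ℝ)/3 + ε) * x ^ ((1:ℝ)/3 + ε) := Real.mul_rpow (by norm_num) hx0.le
        _ ≤ 3 ^ (1:ℝ) * x ^ ((1:ℝ)/3 + ε) := by
            gcongr
            · norm_num
            · linarith
        _ = _ := by rw [Real.rpow_one]
    have b2 := b2 (by linarith)
    rw [e1] at b1
    rw [e2] at b2
    have hL1 : 0 ≤ Real.log y - Real.log x :=
      sub_nonneg.2 (Real.log_le_log hx0 (by linarith))
    have hL2 : y * (Real.log y - Real.log x) ≤ 3 * (y - x) := by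
      have h := Real.log_le_sub_one_of_pos (div_pos hy0 hx0)
      rw [Real.log_div hy0.ne' hx0.ne'] at h
      have h' : x * (Real.log y - Real.log x) ≤ y - x := by
        calc x * (Real.log y - Real.log x) ≤ x * (y / x - 1) := by gcongr
          _ = y - x := by field_simp
      nlinarith [mul_nonneg (sub_nonneg.2 hy3) hL1]
    have hL3 : 0 ≤ y * (Real.log y - Real.log x) := mul_nonneg hy0.le hL1
    have hE : B * x ^ ((1:ℝ)/3 + ε) + B * y ^ ((1:ℝ)/3 + ε) ≤ 8 * B * (y - x) := by
      nlinarith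
    have hcc := abs_le.1 (le_of_eq (abs_mul c (y - x)))
    rw [abs_of_pos hh] at hcc
    have hmain : |ω * (N₀ ν : ℝ) - (y - x) * Real.log x| ≤ (3 + |c| + 8 * B) * (y - x) := by
      rw [abs_le] at b1 b2 ⊢
      constructor <;> nlinarith
    have hd : 0 < (y - x) * Real.log x := mul_pos hh h3
    rw [Real.norm_eq_abs, div_sub_one hd.ne', abs_div, abs_of_pos hd,
      div_le_div_iff₀ hd h3]
    calc _ ≤ (3 + |c| + 8 * B) * (y - x) * Real.log x := by gcongr
      _ = _ := by ring
  have := key.inv₀ one_ne_zero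
  rw [inv_one] at this
  refine this.congr fun ν => ?_
  have hs := Finset.sum_range_sub (fun k => T (ν + k)) (N₀ ν)
  simp only [← add_assoc, add_zero] at hs
  rw [hs, inv_div]
  simp only [div_eq_mul_inv, mul_inv]
  ring
end
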